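/- For every A ∈ GL(n,k), every B ∈ T_-(β_1,...,β_q), every C ∈ T_+(α_1,...,α_p), and all indices 1 ≤ i ≤ p, 1 ≤ j ≤ q, one has χ_ij(B·A·C) = χ_ij(A). In other words, the linear relations χ_ij(A) depend only on the double coset T_-(β_1,...,β_q)·A·T_+(α_1,...,α_p). (Proposition 1(a).) -/

import Mathlib

namespace Neretin

open scoped BigOperators

variable {k : Type*} [Field k]

/-- Offset of the `i`-th block of the partition `α`. -/
def off {p : ℕ} (α : Fin p → ℕ) (i : Fin p) : ℕ := ∑ i' ∈ Finset.Iio i, α i'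

theorem coord_lt {p n : ℕ} {α : Fin p → ℕ} (hα : ∑ i, α i = n) (i : Fin p)
    (t : Fin (α i)) : off α i + (t : ℕ) < n := by
  have h1 : off α i + α i ≤ n := by
    rw [← hα]
    have h2 : insert i (Finset.Iio i) = Finset.Iic i := Finset.Iio_insert i
    have h3 : off α i + α i = ∑ i' ∈ Finset.Iic i, α i' := by
      rw [← h2, Finset.sum_insert (by simp)]
      unfold off
      omega
    rw [h3]
    exact Finset.sum_le_sum_of_subset (Finset.subset_univ _)
  have h4 := t.isLt
  omega

/-- The coordinate of `k^n` corresponding to the `t`-th coordinate of the `i`-th block. -/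
def coord {p n : ℕ} {α : Fin p → ℕ} (hα : ∑ i, α i = n) (i : Fin p) (t : Fin (α i)) : Fin n :=
  ⟨off α i + (t : ℕ), coord_lt hα i t⟩

/-- Subspace of vectors vanishing at all coordinates satisfying `P`. -/
def vanishOn {ι : Type*} (P : ι → Prop) : Submodule k (ι → k) :=
  ⨅ r ∈ {r : ι | P r}, LinearMap.ker (LinearMap.proj (R := k) (φ := fun _ : ι => k) r)

/-- The linear relation `χ_ij(A) : V_i ⇉ W_j`. -/
def chi {p q n : ℕ} (α : Fin p → ℕ) (β : Fin q → ℕ) (hα : ∑ i, α i = n) (hβ : ∑ j, β j = n)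
    (A : Matrix (Fin n) (Fin n) k) (i : Fin p) (j : Fin q) :
    Submodule k ((Fin (α i) → k) × (Fin (β j) → k)) :=
  Submodule.map
    ((LinearMap.funLeft k k (coord hα i)).prod
      ((LinearMap.funLeft k k (coord hβ j)).comp (Matrix.mulVecLin A)))
    (vanishOn (fun r : Fin n => off α i + α i ≤ (r : ℕ)) ⊓
      Submodule.comap (Matrix.mulVecLin A) (vanishOn fun r : Fin n => (r : ℕ) < off β j))

section Rel

variable {X Y : Type*} [AddCommGroup X] [Module k X] [AddCommGroup Y] [Module k Y]

/-- Kernel of a linear relation. -/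
def rker (L : Submodule k (X × Y)) : Submodule k X := Submodule.comap (LinearMap.inl k X Y) L

/-- Domain of a linear relation. -/
def rdom (L : Submodule k (X × Y)) : Submodule k X := Submodule.map (LinearMap.fst k X Y) L

/-- Image of a linear relation. -/
def rim (L : Submodule k (X × Y)) : Submodule k Y := Submodule.map (LinearMap.snd k X Y) L

/-- Indefiniteness of a linear relation. -/
def rindef (L : Submodule k (X × Y)) : Submodule k Y := Submodule.comap (LinearMap.inr k X Y) L

end Rel

/-- `blockLT α a b`: coordinate `a` lies in a strictly earlier block than `b`. -/
def blockLT {p : ℕ} (α : Fin p → ℕ) (a b : ℕ) : Prop :=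
  ∃ i : Fin p, off α i ≤ b ∧ a < off α i

/-- `sameBlock α a b` : coordinates `a`, `b` lie in the same block. -/
def sameBlock {p : ℕ} (α : Fin p → ℕ) (a b : ℕ) : Prop :=
  ∀ i : Fin p, off α i ≤ a ↔ off α i ≤ b

/-- Block upper triangular matrices (the group `P_+`). -/
def IsPPlus {n p : ℕ} (α : Fin p → ℕ) (g : Matrix (Fin n) (Fin n) k) : Prop :=
  ∀ r s : Fin n, blockLT α (s : ℕ) (r : ℕ) → g r s = 0

/-- Block lower triangular matrices (the group `P_-`). -/
def IsPMinus {n p : ℕ} (α : Fin p → ℕ) (g : Matrix (Fin n) (Fin n) k) : Prop :=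
  ∀ r s : Fin n, blockLT α (r : ℕ) (s : ℕ) → g r s = 0

/-- Block strictly upper triangular matrices (the group `T_+`). -/
def IsTPlus {n p : ℕ} (α : Fin p → ℕ) (g : Matrix (Fin n) (Fin n) k) : Prop :=
  IsPPlus α g ∧ ∀ r s : Fin n, sameBlock α (r : ℕ) (s : ℕ) → g r s = if r = s then 1 else 0

/-- Block strictly lower triangular matrices (the group `T_-`). -/
def IsTMinus {n p : ℕ} (α : Fin p → ℕ) (g : Matrix (Fin n) (Fin n) k) : Prop :=
  IsPMinus α g ∧ ∀ r s : Fin n, sameBlock α (r : ℕ) (s : ℕ) → g r s = if r = s then 1 else 0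

/-- Bi-hinges. -/
def IsBiHinge {p q : ℕ} (α : Fin p → ℕ) (β : Fin q → ℕ)
    (ξ : (i : Fin p) → (j : Fin q) → Submodule k ((Fin (α i) → k) × (Fin (β j) → k))) : Prop :=
  (∀ (i : Fin p) (j j' : Fin q), (j' : ℕ) = (j : ℕ) + 1 → rker (ξ i j) = rdom (ξ i j')) ∧
  (∀ (i i' : Fin p) (j : Fin q), (i' : ℕ) = (i : ℕ) + 1 → rim (ξ i j) = rindef (ξ i' j)) ∧
  (∀ (i : Fin p) (j : Fin q), (i : ℕ) = 0 → rindef (ξ i j) = ⊥) ∧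
  (∀ (i : Fin p) (j : Fin q), (i : ℕ) + 1 = p → rim (ξ i j) = ⊤) ∧
  (∀ (i : Fin p) (j : Fin q), (j : ℕ) + 1 = q → rker (ξ i j) = ⊥) ∧
  (∀ (i : Fin p) (j : Fin q), (j : ℕ) = 0 → rdom (ξ i j) = ⊤)

/-- 0-1 matrices with exactly one unit in each row and each column. -/
def IsPermMatrix {n : ℕ} (M : Matrix (Fin n) (Fin n) k) : Prop :=
  ∃ σ : Equiv.Perm (Fin n), ∀ r s, M r s = if r = σ s then 1 else 0

/-- Offset of the sub-block `V_i^j` inside `V_i`. -/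
def offA {p q : ℕ} (a : Fin p → Fin q → ℕ) (i : Fin p) (j : Fin q) : ℕ :=
  ∑ j' ∈ Finset.Iio j, a i j'

/-- Offset of the sub-block `W_j^i` inside `W_j`. -/
def offB {p q : ℕ} (a : Fin p → Fin q → ℕ) (i : Fin p) (j : Fin q) : ℕ :=
  ∑ i' ∈ Finset.Iio i, a i' j

open Classical in
/-- The standard 0-1 matrix determined by the dimension data `a`. -/
noncomputable def stdMatrix {p q : ℕ} (n : ℕ) (α : Fin p → ℕ) (β : Fin q → ℕ)
    (a : Fin p → Fin q → ℕ) : Matrix (Fin n) (Fin n) k :=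
  Matrix.of fun r s : Fin n =>
    if ∃ (i : Fin p) (j : Fin q) (t : ℕ), t < a i j ∧
        (s : ℕ) = off α i + offA a i j + t ∧ (r : ℕ) = off β j + offB a i j + t
      then (1 : k) else 0

/-- The standard bi-hinge determined by the dimension data `a`. -/
def stdHinge {p q : ℕ} (α : Fin p → ℕ) (β : Fin q → ℕ) (a : Fin p → Fin q → ℕ)
    (i : Fin p) (j : Fin q) : Submodule k ((Fin (α i) → k) × (Fin (β j) → k)) where
  carrier := {z | (∀ u : Fin (α i), (u : ℕ) < offA a i j → z.1 u = 0) ∧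
    (∀ v : Fin (β j), offB a i j + a i j ≤ (v : ℕ) → z.2 v = 0) ∧
    ∀ (u : Fin (α i)) (v : Fin (β j)) (t : ℕ), t < a i j →
      (u : ℕ) = offA a i j + t → (v : ℕ) = offB a i j + t → z.1 u = z.2 v}
  add_mem' := by
    rintro x y ⟨hx1, hx2, hx3⟩ ⟨hy1, hy2, hy3⟩
    refine ⟨fun u hu => ?_, fun v hv => ?_, fun u v t ht hu hv => ?_⟩
    · show x.1 u + y.1 u = 0
      rw [hx1 u hu, hy1 u hu, add_zero]
    · show x.2 v + y.2 v = 0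
      rw [hx2 v hv, hy2 v hv, add_zero]
    · show x.1 u + y.1 u = x.2 v + y.2 v
      rw [hx3 u v t ht hu hv, hy3 u v t ht hu hv]
  zero_mem' := ⟨fun _ _ => rfl, fun _ _ => rfl, fun _ _ _ _ _ _ => rfl⟩
  smul_mem' := by
    rintro c x ⟨hx1, hx2, hx3⟩
    refine ⟨fun u hu => ?_, fun v hv => ?_, fun u v t ht hu hv => ?_⟩
    · show c * x.1 u = 0
      rw [hx1 u hu, mul_zero]
    · show c * x.2 v = 0
      rw [hx2 v hv, mul_zero]
    · show c * x.1 u = c * x.2 v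
      rw [hx3 u v t ht hu hv]

theorem mem_vanishOn {ι : Type*} {P : ι → Prop} {x : ι → k} :
    x ∈ vanishOn (k := k) P ↔ ∀ r, P r → x r = 0 := by
  simp [vanishOn, Submodule.mem_iInf]

theorem off_add_eq_sum_Iic {p : ℕ} (α : Fin p → ℕ) (i : Fin p) :
    off α i + α i = ∑ i' ∈ Finset.Iic i, α i' := by
  rw [← Finset.Iio_insert, Finset.sum_insert (by simp), off, add_comm]

theorem off_mono {p : ℕ} (α : Fin p → ℕ) : Monotone (off α) := fun _ _ h =>
  Finset.sum_le_sum_of_subset (Finset.Iio_subset_Iio h)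

theorem off_add_le_off {p : ℕ} (α : Fin p → ℕ) {i i' : Fin p} (h : i < i') :
    off α i + α i ≤ off α i' := by
  rw [off_add_eq_sum_Iic]
  exact Finset.sum_le_sum_of_subset (fun a ha => by
    simp only [Finset.mem_Iic, Finset.mem_Iio] at *
    exact ha.trans_lt h)

/-- The end of a block that is not the end of `k^n` is the start of another block. -/
theorem exists_off_eq_off_add {p n : ℕ} {α : Fin p → ℕ} (hα : ∑ i, α i = n) (i : Fin p)
    (h : off α i + α i < n) : ∃ i' : Fin p, off α i' = off α i + α i := by
  by_cases hi : (i : ℕ) + 1 < p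
  · refine ⟨⟨i + 1, hi⟩, ?_⟩
    rw [off_add_eq_sum_Iic, off]
    congr 1
    ext a
    simp only [Finset.mem_Iic, Finset.mem_Iio, Fin.lt_def, Fin.le_def]
    omega
  · rw [off_add_eq_sum_Iic, ← hα] at h
    have : Finset.Iic i = Finset.univ := by
      ext a
      simp only [Finset.mem_Iic, Finset.mem_univ, Fin.le_def, iff_true]
      omega
    simp [this] at h

theorem blockLT_of_lt_of_le {p n : ℕ} {α : Fin p → ℕ} (hα : ∑ i, α i = n) (i : Fin p)
    {a b : ℕ} (ha : a < off α i + α i) (hb : off α i + α i ≤ b) (hbn : b < n) :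
    blockLT α a b := by
  obtain ⟨i', hi'⟩ := exists_off_eq_off_add hα i (hb.trans_lt hbn)
  exact ⟨i', by omega, by omega⟩

theorem sameBlock_of_mem {p : ℕ} {α : Fin p → ℕ} (i : Fin p) {a b : ℕ}
    (ha : off α i ≤ a) (ha' : a < off α i + α i) (hb : off α i ≤ b)
    (hb' : b < off α i + α i) : sameBlock α a b := by
  intro i'
  rcases le_or_gt i' i with h | h
  · have := off_mono α h
    omega
  · have := off_add_le_off α h
    omega

/-- An invertible matrix mapping a subspace into itself maps it onto itself. -/
theorem map_mulVecLin_eq_of_le {ι : Type*} [Fintype ι] [DecidableEq ι] (g : GL ι k)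
    (U : Submodule k (ι → k)) (h : U.map g.val.mulVecLin ≤ U) : U.map g.val.mulVecLin = U :=
  Submodule.eq_of_le_of_finrank_eq h
    (Submodule.equivMapOfInjective _
      (Matrix.mulVec_injective_iff_isUnit.mpr g.isUnit) U).finrank_eq.symm

theorem map_vanishOn_of_isTPlus {p n : ℕ} {α : Fin p → ℕ} (hα : ∑ i, α i = n)
    (C : GL (Fin n) k) (hC : IsTPlus α C.val) (i : Fin p) :
    (vanishOn (k := k) fun r : Fin n => off α i + α i ≤ (r : ℕ)).map C.val.mulVecLin =
      vanishOn fun r : Fin n => off α i + α i ≤ (r : ℕ) := by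
  refine map_mulVecLin_eq_of_le C _ (Submodule.map_le_iff_le_comap.mpr fun x hx => ?_)
  rw [Submodule.mem_comap, mem_vanishOn]
  rw [mem_vanishOn] at hx
  intro r hr
  rw [Matrix.mulVecLin_apply, Matrix.mulVec, dotProduct]
  refine Finset.sum_eq_zero fun s _ => ?_
  rcases le_or_gt (off α i + α i) s with hs | hs
  · rw [hx s hs, mul_zero]
  · rw [hC.1 r s (blockLT_of_lt_of_le hα i hs hr r.isLt), zero_mul]

theorem map_vanishOn_of_isTMinus {q n : ℕ} {β : Fin q → ℕ}
    (B : GL (Fin n) k) (hB : IsTMinus β B.val) (j : Fin q) :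
    (vanishOn (k := k) fun r : Fin n => (r : ℕ) < off β j).map B.val.mulVecLin =
      vanishOn fun r : Fin n => (r : ℕ) < off β j := by
  refine map_mulVecLin_eq_of_le B _ (Submodule.map_le_iff_le_comap.mpr fun x hx => ?_)
  rw [Submodule.mem_comap, mem_vanishOn]
  rw [mem_vanishOn] at hx
  intro r hr
  rw [Matrix.mulVecLin_apply, Matrix.mulVec, dotProduct]
  refine Finset.sum_eq_zero fun s _ => ?_
  rcases lt_or_ge (s : ℕ) (off β j) with hs | hs
  · rw [hx s hs, mul_zero]
  · rw [hB.1 r s ⟨j, hs, hr⟩, zero_mul]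

/-- If row `r` of `g` agrees with the identity wherever `x` is nonzero, then `g` fixes the
`r`-th coordinate of `x`. -/
theorem mulVec_apply_eq_self {ι : Type*} [Fintype ι] [DecidableEq ι] {g : Matrix ι ι k}
    {x : ι → k} {r : ι} (h : ∀ s, x s = 0 ∨ g r s = if r = s then 1 else 0) :
    g.mulVec x r = x r := by
  calc g.mulVec x r = ∑ s, (if r = s then x s else 0) := Finset.sum_congr rfl fun s _ => by
        rcases h s with h | h
        · simp [h]
        · simp [h]
    _ = x r := by simp

theorem funLeft_mulVec_of_isTPlus {p n : ℕ} {α : Fin p → ℕ} (hα : ∑ i, α i = n)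
    {C : Matrix (Fin n) (Fin n) k} (hC : IsTPlus α C) (i : Fin p) {x : Fin n → k}
    (hx : x ∈ vanishOn (k := k) fun r : Fin n => off α i + α i ≤ (r : ℕ)) :
    LinearMap.funLeft k k (coord hα i) (C.mulVec x) = LinearMap.funLeft k k (coord hα i) x := by
  rw [mem_vanishOn] at hx
  ext t
  rw [LinearMap.funLeft_apply, LinearMap.funLeft_apply]
  refine mulVec_apply_eq_self fun s => ?_
  have hr : off α i ≤ (coord hα i t : ℕ) := Nat.le_add_right _ _
  have hr' : (coord hα i t : ℕ) < off α i + α i := Nat.add_lt_add_left t.isLt _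
  rcases le_or_gt (off α i + α i) s with hs | hs
  · exact .inl (hx s hs)
  · refine .inr ?_
    rcases lt_or_ge (s : ℕ) (off α i) with hs' | hs'
    · rw [hC.1 _ s ⟨i, hr, hs'⟩, if_neg]
      rintro rfl
      omega
    · exact hC.2 _ s (sameBlock_of_mem i hr hr' hs' hs)

theorem funLeft_mulVec_of_isTMinus {q n : ℕ} {β : Fin q → ℕ} (hβ : ∑ j, β j = n)
    {B : Matrix (Fin n) (Fin n) k} (hB : IsTMinus β B) (j : Fin q) {y : Fin n → k}
    (hy : y ∈ vanishOn (k := k) fun r : Fin n => (r : ℕ) < off β j) :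
    LinearMap.funLeft k k (coord hβ j) (B.mulVec y) = LinearMap.funLeft k k (coord hβ j) y := by
  rw [mem_vanishOn] at hy
  ext t
  rw [LinearMap.funLeft_apply, LinearMap.funLeft_apply]
  refine mulVec_apply_eq_self fun s => ?_
  have hr : off β j ≤ (coord hβ j t : ℕ) := Nat.le_add_right _ _
  have hr' : (coord hβ j t : ℕ) < off β j + β j := Nat.add_lt_add_left t.isLt _
  rcases lt_or_ge (s : ℕ) (off β j) with hs | hs
  · exact .inl (hy s hs)
  · refine .inr ?_
    rcases le_or_gt (off β j + β j) s with hs' | hs'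
    · rw [hB.1 _ s (blockLT_of_lt_of_le hβ j hr' hs' s.isLt), if_neg]
      rintro rfl
      omega
    · exact hB.2 _ s (sameBlock_of_mem j hr hr' hs hs')

theorem mem_chi {p q n : ℕ} {α : Fin p → ℕ} {β : Fin q → ℕ} (hα : ∑ i, α i = n)
    (hβ : ∑ j, β j = n) (A : Matrix (Fin n) (Fin n) k) (i : Fin p) (j : Fin q)
    (z : (Fin (α i) → k) × (Fin (β j) → k)) :
    z ∈ chi α β hα hβ A i j ↔
      ∃ x ∈ vanishOn (k := k) fun r : Fin n => off α i + α i ≤ (r : ℕ),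
        A.mulVec x ∈ vanishOn (k := k) (fun r : Fin n => (r : ℕ) < off β j) ∧
        (LinearMap.funLeft k k (coord hα i) x,
          LinearMap.funLeft k k (coord hβ j) (A.mulVec x)) = z := by
  simp only [chi, Submodule.mem_map, Submodule.mem_inf, Submodule.mem_comap, and_assoc]
  rfl

/-- Left multiplication by `T_-` does not change `χ_ij`. -/
theorem chi_mul_left {p q n : ℕ} {α : Fin p → ℕ} {β : Fin q → ℕ} (hα : ∑ i, α i = n)
    (hβ : ∑ j, β j = n) (A : Matrix (Fin n) (Fin n) k) (B : GL (Fin n) k)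
    (hB : IsTMinus β B.val) (i : Fin p) (j : Fin q) :
    chi α β hα hβ (B.val * A) i j = chi α β hα hβ A i j := by
  have hmem (y : Fin n → k) :
      B.val.mulVec y ∈ vanishOn (k := k) (fun r : Fin n => (r : ℕ) < off β j) ↔
        y ∈ vanishOn (k := k) (fun r : Fin n => (r : ℕ) < off β j) := by
    conv_lhs => rw [← map_vanishOn_of_isTMinus B hB j]
    exact (Matrix.mulVec_injective_iff_isUnit.mpr B.isUnit).mem_set_image
  ext1 z
  simp only [mem_chi, ← Matrix.mulVec_mulVec, hmem]
  refine exists_congr fun x => and_congr_right fun _ => and_congr_right fun hy => ?_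
  rw [funLeft_mulVec_of_isTMinus hβ hB j hy]

/-- Right multiplication by `T_+` does not change `χ_ij`. -/
theorem chi_mul_right {p q n : ℕ} {α : Fin p → ℕ} {β : Fin q → ℕ} (hα : ∑ i, α i = n)
    (hβ : ∑ j, β j = n) (A : Matrix (Fin n) (Fin n) k) (C : GL (Fin n) k)
    (hC : IsTPlus α C.val) (i : Fin p) (j : Fin q) :
    chi α β hα hβ (A * C.val) i j = chi α β hα hβ A i j := by
  ext1 z
  rw [mem_chi, mem_chi]
  conv_rhs => rw [← map_vanishOn_of_isTPlus hα C hC i]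
  simp only [Submodule.mem_map, exists_exists_and_eq_and, Matrix.mulVecLin_apply,
    ← Matrix.mulVec_mulVec]
  refine exists_congr fun x => and_congr_right fun hx => ?_
  rw [funLeft_mulVec_of_isTPlus hα hC i hx]

theorem statement0 (p q n : ℕ) (hp : 0 < p) (hq : 0 < q)
    (α : Fin p → ℕ) (β : Fin q → ℕ)
    (hαpos : ∀ i, 0 < α i) (hβpos : ∀ j, 0 < β j)
    (hα : ∑ i, α i = n) (hβ : ∑ j, β j = n)
    (A B C : GL (Fin n) k) (hB : IsTMinus β B.val) (hC : IsTPlus α C.val)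
    (i : Fin p) (j : Fin q) :
    chi α β hα hβ ((B * A * C).val) i j = chi α β hα hβ A.val i j := by
  rw [Units.val_mul, Units.val_mul, chi_mul_right hα hβ _ C hC, chi_mul_left hα hβ _ B hB]

end Neretin
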